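/- arXiv:0801.0848 — 4 statements merged into one kernel-verified Lean document; each statement's English description precedes it below -/
import Mathlib

section
/- Let G be a simple graph on a finite vertex set V and let S be a perfect community of G whose vertices have common degree d. Then every vector x : V → ℝ that vanishes on V \ S and whose coordinates over S sum to zero satisfies L̃ x = (d+1) x, where L̃ is the Laplacian matrix of G. In particular every nonzero such vector is an eigenvector of L̃ for the eigenvalue d+1. -/
/-- `S` is a perfect community of the simple graph `G`: it has at least two vertices,
every two distinct vertices of `S` are adjacent, and every two vertices of `S` have
exactly the same neighbors outside `S`. -/
def IsPerfectCommunity {V : Type*} [Fintype V] [DecidableEq V]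
    (G : SimpleGraph V) [DecidableRel G.Adj] (S : Finset V) : Prop :=
  2 ≤ S.card ∧
  (∀ u ∈ S, ∀ v ∈ S, u ≠ v → G.Adj u v) ∧
  (∀ u ∈ S, ∀ v ∈ S, ∀ w ∉ S, (G.Adj w u ↔ G.Adj w v))

/-- If `S` is a perfect community whose vertices have common degree `d`, then every
vector vanishing outside `S` whose coordinates over `S` sum to zero satisfies
`L̃ x = (d+1) x`; in particular every nonzero such vector is an eigenvector of the
Laplacian `L̃` for the eigenvalue `d+1`. -/
theorem perfectCommunity_laplacian_eigen {V : Type*} [Fintype V] [DecidableEq V]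
    (G : SimpleGraph V) [DecidableRel G.Adj] (S : Finset V)
    (hS : IsPerfectCommunity G S) (d : ℕ) (hd : ∀ v ∈ S, G.degree v = d)
    (x : V → ℝ) (hx0 : ∀ v ∉ S, x v = 0) (hxsum : ∑ v ∈ S, x v = 0) :
    (G.lapMatrix ℝ).mulVec x = ((d : ℝ) + 1) • x ∧
    (x ≠ 0 →
      Module.End.HasEigenvector (G.lapMatrix ℝ).mulVecLin ((d : ℝ) + 1) x) := by
  obtain ⟨_, hadj, hout⟩ := hS
  have key : (G.lapMatrix ℝ).mulVec x = ((d : ℝ) + 1) • x := by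
    funext v
    rw [SimpleGraph.lapMatrix_mulVec_apply, Pi.smul_apply, smul_eq_mul]
    have h1 : ∑ u ∈ G.neighborFinset v, x u = ∑ u ∈ S, if G.Adj v u then x u else 0 := by
      rw [SimpleGraph.neighborFinset_eq_filter, Finset.sum_filter]
      symm
      apply Finset.sum_subset (Finset.subset_univ S)
      intro u _ hu
      simp [hx0 u hu]
    rw [h1]
    by_cases hv : v ∈ S
    · have h2 : ∑ u ∈ S, (if G.Adj v u then x u else 0)
          = ∑ u ∈ S, (x u - if v = u then x u else 0) := by
        apply Finset.sum_congr rfl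
        intro u hu
        by_cases h : v = u
        · subst h
          simp
        · simp [h, hadj v hv u hu h]
      rw [h2, Finset.sum_sub_distrib, hxsum, Finset.sum_ite_eq, if_pos hv, hd v hv]
      ring
    · have h2 : ∑ u ∈ S, (if G.Adj v u then x u else 0) = 0 := by
        by_cases h : ∃ w ∈ S, G.Adj v w
        · obtain ⟨w, hw, hvw⟩ := h
          rw [← hxsum]
          apply Finset.sum_congr rfl
          intro u hu
          rw [if_pos ((hout w hw u hu v hv).1 hvw)]
        · apply Finset.sum_eq_zero
          intro u hu
          rw [if_neg (fun h' => h ⟨u, hu, h'⟩)]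
      rw [h2, hx0 v hv]
      ring
  refine ⟨key, fun hne => ?_⟩
  rw [Module.End.hasEigenvector_iff, Module.End.mem_eigenspace_iff]
  exact ⟨key, hne⟩
end

section
/- Let G be a simple graph on a finite vertex set V and let S be a perfect community of G with |S| = k and common vertex degree d. Then the subspace of ℝ^V consisting of vectors that vanish on V \ S and whose coordinates over S sum to zero has dimension exactly k − 1, and it is contained in the eigenspace of the Laplacian L̃ for the eigenvalue d+1; consequently d+1 is a nonzero eigenvalue of L̃ of multiplicity at least k − 1. -/
/-- The subspace of `ℝ^V` of vectors vanishing outside `S` and whose coordinates over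
`S` sum to zero. -/
def commSubspace {V : Type*} [Fintype V] [DecidableEq V] (S : Finset V) :
    Submodule ℝ (V → ℝ) where
  carrier := {x | (∀ v ∉ S, x v = 0) ∧ ∑ v ∈ S, x v = 0}
  add_mem' := by
    rintro a b ⟨ha1, ha2⟩ ⟨hb1, hb2⟩
    refine ⟨fun v hv => ?_, ?_⟩
    · simp [Pi.add_apply, ha1 v hv, hb1 v hv]
    · simp [Pi.add_apply, Finset.sum_add_distrib, ha2, hb2]
  zero_mem' := ⟨fun v _ => rfl, by simp⟩
  smul_mem' := by
    rintro c x ⟨hx1, hx2⟩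
    refine ⟨fun v hv => ?_, ?_⟩
    · simp [Pi.smul_apply, hx1 v hv]
    · simp only [Pi.smul_apply, smul_eq_mul, ← Finset.mul_sum, hx2, mul_zero]

/-- If `S` is a perfect community with `|S| = k` and common degree `d`, the subspace of
vectors vanishing outside `S` with zero sum over `S` has dimension exactly `k - 1` and is
contained in the eigenspace of the Laplacian for the eigenvalue `d + 1`; consequently
`d + 1` is a nonzero eigenvalue of the Laplacian of multiplicity at least `k - 1`. -/
theorem perfectCommunity_eigenvalue_multiplicity {V : Type*} [Fintype V] [DecidableEq V]
    (G : SimpleGraph V) [DecidableRel G.Adj] (S : Finset V) (k : ℕ)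
    (hS : IsPerfectCommunity G S) (hk : S.card = k)
    (d : ℕ) (hd : ∀ v ∈ S, G.degree v = d) :
    Module.finrank ℝ (commSubspace S) = k - 1 ∧
    commSubspace S ≤ Module.End.eigenspace (G.lapMatrix ℝ).mulVecLin ((d : ℝ) + 1) ∧
    ((d : ℝ) + 1 ≠ 0) ∧
    k - 1 ≤ Module.finrank ℝ
      (Module.End.eigenspace (G.lapMatrix ℝ).mulVecLin ((d : ℝ) + 1)) := by
  have hA : Module.finrank ℝ (commSubspace S) = k - 1 := by
    obtain ⟨h2, -, -⟩ := hS
    let f : Module.Dual ℝ (S → ℝ) := ∑ i : S, LinearMap.proj i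
    have hfx : ∀ y : S → ℝ, f y = ∑ i : S, y i := fun y => by simp [f]
    have hf : f ≠ 0 := by
      intro h
      have h1 := hfx (fun _ => 1)
      rw [h] at h1
      rw [LinearMap.zero_apply, Finset.sum_const, Finset.card_univ, Fintype.card_coe, nsmul_eq_mul, mul_one, eq_comm, Nat.cast_eq_zero] at h1
      omega
    have h3 := Module.Dual.finrank_ker_add_one_of_ne_zero hf
    have e : commSubspace S ≃ₗ[ℝ] LinearMap.ker f :=
      { toFun := fun x => ⟨fun i => x.1 i.1, by
          rw [LinearMap.mem_ker, hfx]
          rw [Finset.sum_coe_sort S (fun i => x.1 i)]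
          exact x.2.2⟩
        map_add' := fun x y => rfl
        map_smul' := fun c x => rfl
        invFun := fun y => ⟨fun v => if h : v ∈ S then y.1 ⟨v, h⟩ else 0,
          fun v hv => by simp [hv], by
            have := y.2
            rw [LinearMap.mem_ker, hfx] at this
            rw [← Finset.sum_coe_sort, ← this]
            exact Finset.sum_congr rfl (fun i _ => by simp)⟩
        left_inv := fun x => by
          ext v
          by_cases h : v ∈ S
          · simp [h]
          · simp [h, x.2.1 v h]
        right_inv := fun y => by
          ext v
          simp }
    rw [e.finrank_eq]
    simp at h3
    omega
  have hB : commSubspace S ≤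
      Module.End.eigenspace (G.lapMatrix ℝ).mulVecLin ((d : ℝ) + 1) := by
    rintro x ⟨hx0, hxs⟩
    obtain ⟨-, hadj, hout⟩ := hS
    rw [Module.End.mem_eigenspace_iff]
    ext v
    have hsum : ∑ u ∈ G.neighborFinset v, x u = ∑ u ∈ S, if G.Adj v u then x u else 0 := by
      rw [← Finset.sum_filter]
      symm
      apply Finset.sum_subset
      · intro u hu
        simp at hu ⊢
        exact hu.2
      · intro u hu hu'
        apply hx0
        intro h
        simp at hu hu'
        exact hu' h hu
    rw [Matrix.mulVecLin_apply, SimpleGraph.lapMatrix_mulVec_apply, hsum]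
    simp only [Pi.smul_apply, smul_eq_mul]
    by_cases hv : v ∈ S
    · have : (∑ u ∈ S, if G.Adj v u then x u else 0) = - x v := by
        have h1 : ∀ u ∈ S, (if G.Adj v u then x u else 0) = x u - if v = u then x v else 0 := by
          intro u hu
          by_cases h : v = u
          · subst h; simp
          · simp [h, hadj v hv u hu h]
        rw [Finset.sum_congr rfl h1, Finset.sum_sub_distrib, hxs]
        simp [hv]
      rw [this, hd v hv]
      ring
    · rw [hx0 v hv]
      have : (∑ u ∈ S, if G.Adj v u then x u else 0) = 0 := by
        by_cases h : ∃ u ∈ S, G.Adj v u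
        · obtain ⟨u, hu, hvu⟩ := h
          rw [← hxs]
          exact Finset.sum_congr rfl fun w hw => if_pos ((hout u hu w hw v hv).1 hvu)
        · push Not at h
          exact Finset.sum_eq_zero fun w hw => if_neg (h w hw)
      rw [this]
      ring
  refine ⟨hA, hB, by positivity, ?_⟩
  rw [← hA]
  exact Submodule.finrank_mono hB
end

section
/- Let G be a simple graph on a finite vertex set V, and let S ⊆ V with |S| = k ≥ 2 be a set containing at least two adjacent vertices (a non-stable set). Suppose there exist k − 1 linearly independent vectors u₁, …, u_{k−1} in ℝ^V, each vanishing on V \ S, and a nonzero real number λ such that L̃ uᵢ = λ uᵢ for all i, where L̃ is the Laplacian matrix of G. Then S is a perfect community of G, and λ = d + 1 where d is the (common) degree of any vertex of S. -/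
/-- If a non-stable set `S` of `k ≥ 2` vertices supports `k - 1` linearly independent
eigenvectors of the Laplacian, all vanishing outside `S` and associated with a common
nonzero eigenvalue `λ`, then `S` is a perfect community and `λ = d + 1` where `d` is the
(common) degree of any vertex of `S`. -/
theorem perfectCommunity_of_eigenvectors {V : Type*} [Fintype V] [DecidableEq V]
    (G : SimpleGraph V) [DecidableRel G.Adj] (S : Finset V) (k : ℕ)
    (hk : S.card = k) (hk2 : 2 ≤ k)
    (hns : ∃ a ∈ S, ∃ b ∈ S, G.Adj a b)
    (u : Fin (k - 1) → (V → ℝ)) (hli : LinearIndependent ℝ u)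
    (hvan : ∀ i, ∀ v ∉ S, u i v = 0)
    (lam : ℝ) (hlam : lam ≠ 0)
    (heig : ∀ i, (G.lapMatrix ℝ).mulVec (u i) = lam • u i) :
    IsPerfectCommunity G S ∧ ∀ v ∈ S, lam = (G.degree v : ℝ) + 1 := by
  classical
  have hsum : ∀ i, ∑ v, u i v = 0 := by
    intro i
    have h1 : ∑ v, ((G.lapMatrix ℝ).mulVec (u i)) v = 0 := by
      have h2 : (fun _ : V => (1 : ℝ)) ⬝ᵥ ((G.lapMatrix ℝ).mulVec (u i)) = 0 := by
        rw [Matrix.dotProduct_mulVec, ← Matrix.mulVec_transpose, (G.isSymm_lapMatrix (R := ℝ)).eq,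
          SimpleGraph.lapMatrix_mulVec_const_eq_zero, zero_dotProduct]
      simpa [dotProduct] using h2
    rw [heig i] at h1
    simp only [Pi.smul_apply, smul_eq_mul, ← Finset.mul_sum] at h1
    exact (mul_eq_zero.mp h1).resolve_left hlam
  let E : (S → ℝ) →ₗ[ℝ] (V → ℝ) :=
    { toFun := fun x v => if h : v ∈ S then x ⟨v, h⟩ else 0
      map_add' := by intro x y; ext v; by_cases h : v ∈ S <;> simp [h]
      map_smul' := by intro c x; ext v; by_cases h : v ∈ S <;> simp [h] }
  let u' : Fin (k - 1) → (S → ℝ) := fun i v => u i v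
  have hE : E ∘ u' = u := by
    ext i v
    by_cases h : v ∈ S
    · simp [E, u', h]
    · simp [E, h, hvan i v h]
  have hli' : LinearIndependent ℝ u' := by
    apply LinearIndependent.of_comp E
    rw [hE]; exact hli
  let σ : (S → ℝ) →ₗ[ℝ] ℝ := ∑ v, LinearMap.proj v
  have hσ : ∀ x, σ x = ∑ v, x v := by intro x; simp [σ]
  have hsp : Submodule.span ℝ (Set.range u') ≤ LinearMap.ker σ := by
    rw [Submodule.span_le]
    rintro _ ⟨i, rfl⟩
    simp only [SetLike.mem_coe, LinearMap.mem_ker, hσ, u']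
    rw [Finset.sum_coe_sort S (fun v => u i v), ← hsum i]
    exact Finset.sum_subset (Finset.subset_univ _) (fun v _ h => hvan i v h)
  obtain ⟨a, ha, b, hb, hab⟩ := hns
  have hσ0 : σ ≠ 0 := by
    intro h
    have := hσ (Pi.single ⟨a, ha⟩ 1)
    rw [h] at this
    simp at this
  have hfr : Module.finrank ℝ (LinearMap.ker σ) = k - 1 := by
    have h1 := LinearMap.finrank_range_add_finrank_ker σ
    rw [LinearMap.range_eq_top.mpr (LinearMap.surjective hσ0), finrank_top] at h1
    simp at h1
    omega
  have heq : Submodule.span ℝ (Set.range u') = LinearMap.ker σ := by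
    apply Submodule.eq_of_le_of_finrank_eq hsp
    rw [finrank_span_eq_card hli', hfr, Fintype.card_fin]
  have hker : LinearMap.ker σ ≤
      LinearMap.ker ((Matrix.toLin' (G.lapMatrix ℝ) - lam • LinearMap.id) ∘ₗ E) := by
    rw [← heq, Submodule.span_le]
    rintro _ ⟨i, rfl⟩
    have : E (u' i) = u i := congrFun hE i
    simp [this, heig i]
  have key : ∀ x ∈ S, ∀ y ∈ S, x ≠ y → ∀ w,
      G.lapMatrix ℝ w x - G.lapMatrix ℝ w y =
        lam * ((if w = x then 1 else 0) - (if w = y then 1 else 0)) := by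
    intro x hx y hy hxy w
    have h1 : (Pi.single ⟨x, hx⟩ 1 - Pi.single ⟨y, hy⟩ 1 : S → ℝ) ∈ LinearMap.ker σ := by
      rw [LinearMap.mem_ker, hσ]; simp
    have h2 := hker h1
    have h3 : E (Pi.single ⟨x, hx⟩ 1 - Pi.single ⟨y, hy⟩ 1) = Pi.single x 1 - Pi.single y 1 := by
      ext v
      by_cases h : v ∈ S
      · simp [E, h, Pi.single_apply]
      · have h4 : v ≠ x := by rintro rfl; exact h hx
        have h5 : v ≠ y := by rintro rfl; exact h hy
        simp [E, h, h4, h5]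
    rw [LinearMap.mem_ker, LinearMap.comp_apply, h3] at h2
    have h4 := congrFun h2 w
    simp [Matrix.mulVec_sub, Pi.single_apply] at h4
    linarith
  have hoff : ∀ w x, w ≠ x → G.lapMatrix ℝ w x = -(if G.Adj w x then 1 else 0) := by
    intro w x h
    simp [SimpleGraph.lapMatrix, SimpleGraph.degMatrix, h, SimpleGraph.adjMatrix_apply]
  have hdiag : ∀ w, G.lapMatrix ℝ w w = G.degree w := by
    intro w
    simp [SimpleGraph.lapMatrix, SimpleGraph.degMatrix]
  have hadj : ∀ x ∈ S, ∀ y ∈ S, ∀ w, w ≠ x → w ≠ y → (G.Adj w x ↔ G.Adj w y) := by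
    intro x hx y hy w hwx hwy
    by_cases hxy : x = y
    · rw [hxy]
    have h := key x hx y hy hxy w
    rw [hoff w x hwx, hoff w y hwy] at h
    by_cases h1 : G.Adj w x <;> by_cases h2 : G.Adj w y <;> simp [h1, h2, hwx, hwy] at h ⊢
  have hcl : ∀ x ∈ S, ∀ y ∈ S, x ≠ y → G.Adj x y := by
    have hA : ∀ y ∈ S, y ≠ a → G.Adj a y := by
      intro y hy hya
      exact (hadj b hb y hy a hab.ne hya.symm).mp hab
    intro x hx y hy hxy
    by_cases hya : y = a
    · subst hya; exact (hA x hx hxy).symm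
    by_cases hxa : x = a
    · subst hxa; exact hA y hy hya
    exact ((hadj a ha x hx y hya hxy.symm).mp (hA y hy hya).symm).symm
  refine ⟨⟨by omega, hcl, ?_⟩, ?_⟩
  · intro x hx y hy w hw
    exact hadj x hx y hy w (by rintro rfl; exact hw hx) (by rintro rfl; exact hw hy)
  · intro v hv
    obtain ⟨w, hw, hwv⟩ := Finset.exists_mem_ne (by omega : 1 < S.card) v
    have h := key v hv w hw hwv.symm v
    rw [hdiag, hoff v w hwv.symm] at h
    simp [hcl v hv w hw hwv.symm, hwv.symm] at h
    linarith
end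

section
/- Let G be a simple graph on a finite vertex set V and let S be a perfect community of G with |S| = k. Let u₁, …, u_{k−1} be k − 1 linearly independent eigenvectors of the Laplacian L̃ of G, each vanishing on V \ S and each associated with a nonzero eigenvalue. Then every eigenvector z of L̃ that is orthogonal (for the standard inner product on ℝ^V) to each of u₁, …, u_{k−1} has constant coordinates on S; that is, z_u = z_v for all u, v ∈ S. -/
/-- Let `S` be a perfect community with `|S| = k` and let `u₁, …, u_{k-1}` be `k - 1`
linearly independent eigenvectors of the Laplacian, vanishing outside `S`, each with a
nonzero eigenvalue. Then every eigenvector `z` of the Laplacian orthogonal to each `uᵢ`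
has constant coordinates on `S`. -/
theorem eigenvector_constant_on_community {V : Type*} [Fintype V] [DecidableEq V]
    (G : SimpleGraph V) [DecidableRel G.Adj] (S : Finset V) (k : ℕ)
    (hS : IsPerfectCommunity G S) (hk : S.card = k)
    (u : Fin (k - 1) → (V → ℝ)) (hli : LinearIndependent ℝ u)
    (hvan : ∀ i, ∀ v ∉ S, u i v = 0)
    (lam : Fin (k - 1) → ℝ) (hlam : ∀ i, lam i ≠ 0)
    (heig : ∀ i, (G.lapMatrix ℝ).mulVec (u i) = lam i • u i)
    (z : V → ℝ) (hz : z ≠ 0) (mu : ℝ)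
    (hze : (G.lapMatrix ℝ).mulVec z = mu • z)
    (horth : ∀ i, ∑ v, z v * u i v = 0) :
    ∀ a ∈ S, ∀ b ∈ S, z a = z b := by
  classical
  have hsum : ∀ i, ∑ v, u i v = 0 := by
    intro i
    have h1 : (fun _ => (1:ℝ)) ⬝ᵥ ((G.lapMatrix ℝ).mulVec (u i)) = 0 := by
      rw [Matrix.dotProduct_mulVec, ← Matrix.mulVec_transpose, (G.isSymm_lapMatrix (R := ℝ)).eq,
        G.lapMatrix_mulVec_const_eq_zero, zero_dotProduct]
    rw [heig] at h1
    simp only [dotProduct, Pi.smul_apply, smul_eq_mul, one_mul, ← Finset.mul_sum] at h1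
    exact (mul_eq_zero.mp h1).resolve_left (hlam i)
  have hrestr : ∀ f : V → ℝ, (∀ v ∉ S, f v = 0) → ∑ v : S, f v = ∑ v, f v := by
    intro f hf
    rw [Finset.sum_coe_sort S f]
    exact Finset.sum_subset (Finset.subset_univ S) (fun v _ hv => hf v hv)
  let u' : Fin (k - 1) → (S → ℝ) := fun i v => u i v
  have hli' : LinearIndependent ℝ u' := by
    apply LinearIndependent.of_comp
      (LinearMap.pi (fun v : V => if h : v ∈ S then LinearMap.proj (⟨v, h⟩ : S) else 0) :
        (S → ℝ) →ₗ[ℝ] (V → ℝ))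
    have he : (LinearMap.pi (fun v : V =>
        if h : v ∈ S then LinearMap.proj (⟨v, h⟩ : S) else 0) :
        (S → ℝ) →ₗ[ℝ] (V → ℝ)) ∘ u' = u := by
      funext i v
      by_cases h : v ∈ S
      · simp [h, u']
      · simp [h, hvan i v h]
    rw [he]
    exact hli
  let σ : (S → ℝ) →ₗ[ℝ] ℝ := ∑ v : S, LinearMap.proj v
  let ζ : (S → ℝ) →ₗ[ℝ] ℝ := ∑ v : S, z v • LinearMap.proj v
  intro a ha b hb
  have hσ : σ ≠ 0 := by
    intro h
    have := LinearMap.congr_fun h (Pi.single ⟨a, ha⟩ 1)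
    simp [σ, Pi.single_apply] at this
  have hle : Submodule.span ℝ (Set.range u') ≤ LinearMap.ker σ := by
    rw [Submodule.span_le]
    rintro _ ⟨i, rfl⟩
    simpa [σ, u'] using (hrestr (u i) (hvan i)).trans (hsum i)
  have hle2 : Submodule.span ℝ (Set.range u') ≤ LinearMap.ker ζ := by
    rw [Submodule.span_le]
    rintro _ ⟨i, rfl⟩
    simpa [ζ, u'] using (hrestr (fun v => z v * u i v)
      (fun v hv => by simp [hvan i v hv])).trans (horth i)
  have heq : Submodule.span ℝ (Set.range u') = LinearMap.ker σ := by
    apply Submodule.eq_of_le_of_finrank_eq hle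
    have h1 := Module.Dual.finrank_ker_add_one_of_ne_zero (f := σ) hσ
    rw [finrank_span_eq_card hli']
    simp only [Module.finrank_fintype_fun_eq_card, Fintype.card_coe] at h1
    simp only [Fintype.card_fin]
    omega
  rw [heq] at hle2
  have hm : (Pi.single ⟨a, ha⟩ 1 - Pi.single ⟨b, hb⟩ 1 : S → ℝ) ∈ LinearMap.ker σ := by
    simp [σ, Pi.single_apply]
  have := hle2 hm
  simp [ζ, Pi.single_apply, mul_sub] at this
  linarith
end
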